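/- Every SOₙ-invariant homogeneous polynomial function of degree (n−k)(n−k−1) on the space of n×n real symmetric matrices vanishing on all symmetric matrices with at most n−k−1 distinct eigenvalues is a real scalar multiple of sDisc_k, and there is no non-zero SOₙ-invariant polynomial of smaller degree vanishing on that set. -/

import Mathlib

/-- The `k`-th subdiscriminant of a family of `n` roots `lam`. -/
noncomputable def sDiscVal {F : Type*} [CommRing F] (n k : ℕ) (lam : Fin n → F) : F :=
  ∑ s ∈ Finset.powersetCard (n - k) (Finset.univ : Finset (Fin n)),
    ∏ p ∈ (s ×ˢ s).filter (fun p => p.1 < p.2), (lam p.1 - lam p.2) ^ 2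

/-- `f` is an `SOₙ`-invariant polynomial function on real symmetric matrices. -/
def SOInvariant (n : ℕ) (f : MvPolynomial (Fin n × Fin n) ℝ) : Prop :=
  ∀ g A : Matrix (Fin n) (Fin n) ℝ, g * g.transpose = 1 → g.det = 1 → A.IsHermitian →
    MvPolynomial.eval (fun p => (g * A * g.transpose) p.1 p.2) f =
      MvPolynomial.eval (fun p => A p.1 p.2) f

/-- `f` vanishes on the set `E_k` of real symmetric matrices with at most `n−k−1`
distinct eigenvalues. -/
def VanishesOnEk (n k : ℕ) (f : MvPolynomial (Fin n × Fin n) ℝ) : Prop :=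
  ∀ (A : Matrix (Fin n) (Fin n) ℝ) (hA : A.IsHermitian),
    (Finset.univ.image hA.eigenvalues).card ≤ n - k - 1 →
    MvPolynomial.eval (fun p => A p.1 p.2) f = 0

open Finset in
theorem Polynomial.eq_zero_of_double_roots {P : Polynomial ℝ} (S : Finset ℝ)
    (hdeg : P.natDegree < 2 * S.card)
    (hS : ∀ a ∈ S, P.eval a = 0 ∧ P.derivative.eval a = 0) : P = 0 := by
  by_contra hP
  have hdvd : ∏ a ∈ S, (X - C a) ^ 2 ∣ P := by
    refine Finset.prod_dvd_of_coprime (fun a _ b _ hab => ?_) fun a ha => ?_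
    · exact (isCoprime_X_sub_C_of_isUnit_sub (sub_ne_zero.2 hab).isUnit).pow
    · refine (le_rootMultiplicity_iff hP).1 ?_
      exact (one_lt_rootMultiplicity_iff_isRoot hP).2 (hS a ha)
  have hle := natDegree_le_of_dvd hdvd hP
  rw [natDegree_prod_of_monic _ _ fun a _ => (monic_X_sub_C a).pow 2] at hle
  simp [natDegree_pow] at hle
  omega

/-- `f` is invariant under permutations of its arguments. -/
def PermInvariant {n : ℕ} (f : (Fin n → ℝ) → ℝ) : Prop :=
  ∀ (e : Equiv.Perm (Fin n)) (x : Fin n → ℝ), f (x ∘ e) = f x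

/-- `f` vanishes at all points with fewer than `m` distinct coordinates. -/
def VanishesBelow {n : ℕ} (m : ℕ) (f : (Fin n → ℝ) → ℝ) : Prop :=
  ∀ x : Fin n → ℝ, (Finset.univ.image x).card < m → f x = 0

open Function in
theorem PermInvariant.update_swap {n : ℕ} {f : (Fin n → ℝ) → ℝ} (hf : PermInvariant f)
    (x : Fin n → ℝ) (s t : Fin n) (z : ℝ) :
    f (update (x ∘ Equiv.swap s t) t z) = f (update x s z) := by
  rw [← hf (Equiv.swap s t) (update x s z)]
  congr 1
  funext i
  rcases eq_or_ne i t with rfl | hi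
  · simp
  · have : Equiv.swap s t i ≠ s := by
      intro h
      rw [Equiv.swap_apply_eq_iff, Equiv.swap_apply_left] at h
      exact hi h
    simp [hi, this]

open Function in
theorem PermInvariant.hasDerivAt_update_zero {n m : ℕ} {f : (Fin n → ℝ) → ℝ}
    (hf : PermInvariant f) (hd : Differentiable ℝ f) (c : Fin n → Fin m)
    (h : ∀ y : Fin m → ℝ, f (y ∘ c) = 0) (y : Fin m → ℝ) (s : Fin n) :
    HasDerivAt (fun z => f (update (y ∘ c) s z)) 0 (y (c s)) := by
  set L := fderiv ℝ f (y ∘ c) with hL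
  have hpart : ∀ t, c t = c s →
      HasDerivAt (fun z => f (update (y ∘ c) t z)) (L (Pi.single t 1)) (y (c s)) := by
    intro t ht
    have h1 : HasFDerivAt f L (update (y ∘ c) t (y (c s))) := by
      rw [← ht, show y (c t) = (y ∘ c) t from rfl, update_eq_self]
      exact (hd _).hasFDerivAt
    exact h1.comp_hasDerivAt _ (hasDerivAt_update (y ∘ c) t (y (c s)))
  have heq : ∀ t, c t = c s → L (Pi.single t 1) = L (Pi.single s 1) := by
    intro t ht
    refine (hpart t ht).unique ?_
    have hswap : (y ∘ c) ∘ Equiv.swap s t = y ∘ c := by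
      funext i
      by_cases his : i = s
      · simp [his, ht]
      by_cases hit : i = t
      · simp [hit, ht]
      simp [Equiv.swap_apply_of_ne_of_ne his hit]
    have hfun := fun z => hf.update_swap (y ∘ c) s t z
    simp only [hswap] at hfun
    simp only [hfun]
    exact hpart s rfl
  have hblock : HasDerivAt (fun z => f (update y (c s) z ∘ c))
      (L (∑ t with c t = c s, Pi.single t 1)) (y (c s)) := by
    have h1 : HasFDerivAt f L (update y (c s) (y (c s)) ∘ c) := by
      rw [update_eq_self]
      exact (hd _).hasFDerivAt
    refine h1.comp_hasDerivAt (y (c s)) ?_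
    rw [hasDerivAt_pi]
    intro i
    by_cases hi : c i = c s
    · have : (∑ t with c t = c s, Pi.single t (1 : ℝ) : Fin n → ℝ) i = 1 := by
        simp [Finset.sum_apply, Pi.single_apply, hi]
      rw [this]
      simpa only [Function.comp_apply, hi, update_self] using hasDerivAt_id' (y (c s))
    · have : (∑ t with c t = c s, Pi.single t (1 : ℝ) : Fin n → ℝ) i = 0 := by
        simp [Finset.sum_apply, Pi.single_apply, hi]
      rw [this]
      simpa [hi] using hasDerivAt_const (y (c s)) (y (c i))
  have hzero : L (∑ t with c t = c s, Pi.single t 1) = 0 := by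
    refine hblock.unique ?_
    simpa [h] using hasDerivAt_const (y (c s)) (0 : ℝ)
  rw [map_sum, Finset.sum_congr rfl fun t ht => heq t (Finset.mem_filter.1 ht).2,
    Finset.sum_const, smul_eq_zero] at hzero
  have hcard : (Finset.univ.filter fun t => c t = c s).card ≠ 0 :=
    Finset.card_ne_zero_of_mem (a := s) (by simp)
  rw [← hzero.resolve_left hcard]
  exact hpart s rfl

open Function in
theorem PermInvariant.vanishesBelow_succ {n m : ℕ} {f : (Fin n → ℝ) → ℝ}
    (hf : PermInvariant f) (hd : Differentiable ℝ f)
    (hdeg : ∀ x s, ∃ P : Polynomial ℝ, P.natDegree < 2 * m ∧ ∀ z, P.eval z = f (update x s z))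
    (hv : VanishesBelow (m + 1) f) : VanishesBelow (m + 2) f := by
  have key : ∀ a, ∀ c : Fin n → Fin (m + 1), (∃ j, (Finset.univ.filter fun i => c i = j).card = a) →
      ∀ y : Fin (m + 1) → ℝ, f (y ∘ c) = 0 := by
    intro a
    induction a with
    | zero =>
      rintro c ⟨j, hj⟩ y
      refine hv _ ?_
      have hsub : Finset.univ.image (y ∘ c) ⊆ (Finset.univ.erase j).image y := by
        intro v hvm
        obtain ⟨i, -, rfl⟩ := Finset.mem_image.1 hvm
        refine Finset.mem_image_of_mem y (Finset.mem_erase.2 ⟨fun hi => ?_, Finset.mem_univ _⟩)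
        exact Finset.card_ne_zero_of_mem (a := i) (by simpa using hi) hj
      calc _ ≤ _ := Finset.card_le_card hsub
        _ ≤ _ := Finset.card_image_le
        _ < m + 1 := by simp
    | succ a ih =>
      rintro c ⟨j, hj⟩ y
      by_cases hy : Injective y
      swap
      · refine hv _ ?_
        have hsub : Finset.univ.image (y ∘ c) ⊆ Finset.univ.image y := by
          intro v hvm
          obtain ⟨i, -, rfl⟩ := Finset.mem_image.1 hvm
          exact Finset.mem_image_of_mem y (Finset.mem_univ _)
        refine (Finset.card_le_card hsub).trans_lt ?_
        refine lt_of_le_of_ne (Finset.card_image_le.trans (by simp)) fun h => hy ?_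
        have hinj := Finset.card_image_iff.1 (h.trans (by simp : m + 1 = Finset.univ.card))
        exact fun u v huv => hinj (by simp) (by simp) huv
      obtain ⟨s, hs⟩ : ∃ s, c s = j := by
        have : 0 < (Finset.univ.filter fun i => c i = j).card := by omega
        obtain ⟨s, hs⟩ := Finset.card_pos.1 this
        exact ⟨s, (Finset.mem_filter.1 hs).2⟩
      obtain ⟨P, hP, hPe⟩ := hdeg (y ∘ c) s
      have hupd : ∀ i, ∀ z, update (y ∘ update c s i) s z = update (y ∘ c) s z := by
        intro i z
        rw [comp_update, update_idem]
      have hroot : ∀ i, i ≠ j → P.eval (y i) = 0 ∧ P.derivative.eval (y i) = 0 := by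
        intro i hi
        have hvi : ∀ y : Fin (m + 1) → ℝ, f (y ∘ update c s i) = 0 := by
          refine ih _ ⟨j, ?_⟩
          have : (Finset.univ.filter fun k => update c s i k = j) =
              (Finset.univ.filter fun k => c k = j).erase s := by
            ext k
            by_cases hk : k = s
            · simp [hk, hi]
            · simp [hk]
          rw [this, Finset.card_erase_of_mem (by simpa using hs), hj, Nat.add_sub_cancel]
        have hder := hf.hasDerivAt_update_zero hd (update c s i) hvi y s
        simp only [hupd, ← hPe, update_self] at hder
        refine ⟨?_, (P.hasDerivAt _).unique hder⟩
        rw [hPe, ← comp_update]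
        exact hvi y
      have hP0 : P = 0 := by
        refine Polynomial.eq_zero_of_double_roots ((Finset.univ.erase j).image y) ?_ ?_
        · rw [Finset.card_image_of_injective _ hy]
          simpa using hP
        · intro b hb
          obtain ⟨i, hi, rfl⟩ := Finset.mem_image.1 hb
          exact hroot i (Finset.ne_of_mem_erase hi)
      have := hPe ((y ∘ c) s)
      rw [update_eq_self, hP0, Polynomial.eval_zero] at this
      exact this.symm
  intro x hx
  have hne : ∃ g : Finset.univ.image x → Fin (m + 1), Injective g := by
    have : Fintype.card (Finset.univ.image x) ≤ Fintype.card (Fin (m + 1)) := by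
      simp only [Fintype.card_coe, Fintype.card_fin]
      omega
    obtain ⟨g⟩ := Function.Embedding.nonempty_of_card_le this
    exact ⟨g, g.injective⟩
  obtain ⟨g, hg⟩ := hne
  let c : Fin n → Fin (m + 1) := fun i => g ⟨x i, Finset.mem_image_of_mem x (Finset.mem_univ i)⟩
  have hxc : x = (extend g (fun v => (v : ℝ)) 0) ∘ c := by
    funext i
    simp [c, hg.extend_apply]
  rw [hxc]
  exact key _ c ⟨0, rfl⟩ _

open Function in
theorem PermInvariant.eq_zero {n m : ℕ} {f : (Fin n → ℝ) → ℝ}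
    (hf : PermInvariant f) (hd : Differentiable ℝ f)
    (hdeg : ∀ x s, ∃ P : Polynomial ℝ, P.natDegree < 2 * m ∧ ∀ z, P.eval z = f (update x s z))
    (hv : VanishesBelow (m + 1) f) (x : Fin n → ℝ) : f x = 0 := by
  have key : ∀ d, VanishesBelow (m + d + 1) f := by
    intro d
    induction d with
    | zero => exact hv
    | succ d ih =>
      refine hf.vanishesBelow_succ hd (m := m + d) (fun x s => ?_) ih
      obtain ⟨P, hP, h⟩ := hdeg x s
      exact ⟨P, by omega, h⟩
  refine key n x ?_
  have : (Finset.univ.image x).card ≤ n := Finset.card_image_le.trans (by simp)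
  omega

/-- The sum of the squared Vandermonde products over the `m`-element subfamilies of `lam`. -/
noncomputable def subdiscSum {F : Type*} [CommRing F] {n : ℕ} (m : ℕ) (lam : Fin n → F) : F :=
  ∑ s ∈ Finset.powersetCard m (Finset.univ : Finset (Fin n)),
    ∏ p ∈ (s ×ˢ s).filter (fun p => p.1 < p.2), (lam p.1 - lam p.2) ^ 2

theorem eval_subdiscSum_X {n : ℕ} (m : ℕ) (x : Fin n → ℝ) :
    MvPolynomial.eval x (subdiscSum m MvPolynomial.X) = subdiscSum m x := by
  simp [subdiscSum, map_sum, map_prod]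

theorem prod_sq_sub_eq_prod_offDiag {n : ℕ} (s : Finset (Fin n)) (x : Fin n → ℝ) :
    ∏ p ∈ (s ×ˢ s).filter (fun p => p.1 < p.2), (x p.1 - x p.2) ^ 2 =
      ∏ p ∈ s.offDiag, |x p.1 - x p.2| := by
  have hsplit : s.offDiag = (s ×ˢ s).filter (fun p => p.1 < p.2) ∪
      (s ×ˢ s).filter (fun p => p.2 < p.1) := by
    ext p
    simp only [Finset.mem_offDiag, Finset.mem_union, Finset.mem_filter, Finset.mem_product,
      ne_iff_lt_or_gt]
    tauto
  have hdisj : Disjoint ((s ×ˢ s).filter (fun p => p.1 < p.2))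
      ((s ×ˢ s).filter (fun p => p.2 < p.1)) := by
    rw [Finset.disjoint_filter]
    intro p _ h
    exact h.asymm
  rw [hsplit, Finset.prod_union hdisj]
  have hswap : ∏ p ∈ (s ×ˢ s).filter (fun p => p.2 < p.1), |x p.1 - x p.2| =
      ∏ p ∈ (s ×ˢ s).filter (fun p => p.1 < p.2), |x p.1 - x p.2| := by
    refine Finset.prod_nbij' Prod.swap Prod.swap ?_ ?_ ?_ ?_ ?_
    · simp +contextual
    · simp +contextual
    · simp
    · simp
    · intro p _
      exact abs_sub_comm _ _
  rw [hswap, ← Finset.prod_mul_distrib]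
  refine Finset.prod_congr rfl fun p _ => ?_
  rw [← sq, sq_abs]

theorem permInvariant_subdiscSum {n : ℕ} (m : ℕ) :
    PermInvariant (fun x : Fin n → ℝ => subdiscSum m x) := by
  intro e x
  simp only [subdiscSum, prod_sq_sub_eq_prod_offDiag]
  refine Finset.sum_nbij' (fun s => s.map e.toEmbedding) (fun s => s.map e.symm.toEmbedding)
    ?_ ?_ ?_ ?_ ?_
  · simp
  · simp
  · intro s _
    simp [Finset.map_map]
  · intro s _
    simp [Finset.map_map]
  · intro s _
    refine Finset.prod_nbij' (fun p => (e p.1, e p.2)) (fun p => (e.symm p.1, e.symm p.2))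
      ?_ ?_ ?_ ?_ ?_
    · simp +contextual [Finset.mem_offDiag]
    · rintro ⟨a, b⟩
      simp only [Finset.mem_offDiag, Finset.mem_map_equiv]
      simp
    · simp
    · simp
    · simp

theorem vanishesBelow_subdiscSum {n : ℕ} (m : ℕ) :
    VanishesBelow m (fun x : Fin n → ℝ => subdiscSum m x) := by
  intro x hx
  refine Finset.sum_eq_zero fun s hs => ?_
  rw [prod_sq_sub_eq_prod_offDiag]
  obtain ⟨a, ha, b, hb, hab, h⟩ := Finset.exists_ne_map_eq_of_card_lt_of_maps_to
    (s := s) (t := Finset.univ.image x) (f := x)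
    (by rwa [(Finset.mem_powersetCard.1 hs).2])
    (fun i _ => by simp)
  exact Finset.prod_eq_zero (i := (a, b)) (by simp [ha, hb, hab]) (by simp [h])

theorem subdiscSum_cons {n : ℕ} (m : ℕ) (z : ℝ) (x : Fin n → ℝ) :
    subdiscSum (m + 1) (Fin.cons z x : Fin (n + 1) → ℝ) = subdiscSum (m + 1) x +
      ∑ s ∈ Finset.powersetCard m (Finset.univ : Finset (Fin n)),
        (∏ p ∈ (s ×ˢ s).filter (fun p => p.1 < p.2), (x p.1 - x p.2) ^ 2) *
          ∏ i ∈ s, (z - x i) ^ 2 := by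
  have hmap : ∀ s : Finset (Fin n),
      ∏ p ∈ (s.map (Fin.succEmb n) ×ˢ s.map (Fin.succEmb n)).filter (fun p => p.1 < p.2),
        ((Fin.cons z x : Fin (n + 1) → ℝ) p.1 - (Fin.cons z x : Fin (n + 1) → ℝ) p.2) ^ 2 =
      ∏ p ∈ (s ×ˢ s).filter (fun p => p.1 < p.2), (x p.1 - x p.2) ^ 2 := by
    intro s
    rw [← Finset.prodMap_map_product, Finset.filter_map, Finset.prod_map]
    simp [Function.comp_def]
  have huniv : (Finset.univ : Finset (Fin (n + 1))) =
      insert 0 (Finset.univ.map (Fin.succEmb n)) := by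
    ext i
    refine Fin.cases ?_ (fun j => ?_) i <;> simp
  rw [subdiscSum, huniv, Finset.powersetCard_succ_insert (by simp), Finset.sum_union]
  swap
  · rw [Finset.disjoint_left]
    intro s hs hs'
    obtain ⟨t, -, rfl⟩ := Finset.mem_image.1 hs'
    have := (Finset.mem_powersetCard.1 hs).1 (Finset.mem_insert_self 0 t)
    simp at this
  congr 1
  · rw [Finset.powersetCard_map, Finset.sum_map, subdiscSum]
    exact Finset.sum_congr rfl fun s _ => hmap s
  · rw [Finset.powersetCard_map, Finset.sum_image, Finset.sum_map]
    · refine Finset.sum_congr rfl fun s _ => ?_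
      rw [← hmap s]
      set t := s.map (Fin.succEmb n) with ht
      have h0 : (0 : Fin (n + 1)) ∉ t := by simp [ht]
      have hset : (insert 0 t ×ˢ insert 0 t).filter (fun p => p.1 < p.2) =
          (t ×ˢ t).filter (fun p => p.1 < p.2) ∪ t.map (Function.Embedding.sectR 0 _) := by
        ext ⟨a, b⟩
        simp only [Finset.mem_filter, Finset.mem_product, Finset.mem_insert, Finset.mem_union,
          Finset.mem_map, Function.Embedding.sectR_apply, Prod.mk.injEq]
        constructor
        · rintro ⟨⟨ha | ha, hb | hb⟩, hab⟩
          · simp [ha, hb] at hab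
          · exact Or.inr ⟨b, hb, ha.symm, rfl⟩
          · simp [hb] at hab
          · exact Or.inl ⟨⟨ha, hb⟩, hab⟩
        · rintro (⟨⟨ha, hb⟩, hab⟩ | ⟨c, hc, rfl, rfl⟩)
          · exact ⟨⟨Or.inr ha, Or.inr hb⟩, hab⟩
          · refine ⟨⟨Or.inl rfl, Or.inr hc⟩, Fin.pos_of_ne_zero ?_⟩
            rintro rfl
            exact h0 hc
      simp only [Finset.mapEmbedding_apply, RelEmbedding.coe_toEmbedding, ← ht]
      rw [hset, Finset.prod_union]
      · rw [Finset.prod_map t, ht, Finset.prod_map s]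
        simp
      · rw [Finset.disjoint_left]
        rintro ⟨a, b⟩ h h'
        simp only [Finset.mem_map, Function.Embedding.sectR_apply, Prod.mk.injEq] at h'
        obtain ⟨c, -, rfl, -⟩ := h'
        simp [h0] at h
    · intro s hs t ht hst
      have hs0 : (0 : Fin (n + 1)) ∉ s := fun h => by
        obtain ⟨s', -, rfl⟩ := Finset.mem_map.1 hs
        simp at h
      have ht0 : (0 : Fin (n + 1)) ∉ t := fun h => by
        obtain ⟨t', -, rfl⟩ := Finset.mem_map.1 ht
        simp at h
      rw [← Finset.erase_insert hs0, ← Finset.erase_insert ht0, hst]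

open Polynomial in
theorem exists_polynomial_subdiscSum_cons {n m : ℕ} (hm : m ≠ 0) (x : Fin n → ℝ) :
    ∃ Q : Polynomial ℝ, Q.natDegree ≤ 2 * m ∧ Q.coeff (2 * m) = subdiscSum m x ∧
      ∀ z, Q.eval z = subdiscSum (m + 1) (Fin.cons z x : Fin (n + 1) → ℝ) := by
  have hprod : ∀ s ∈ Finset.powersetCard m (Finset.univ : Finset (Fin n)),
      (∏ i ∈ s, (X - C (x i)) ^ 2).natDegree = 2 * m ∧
        (∏ i ∈ s, (X - C (x i)) ^ 2).Monic := by
    intro s hs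
    refine ⟨?_, monic_prod_of_monic _ _ fun i _ => (monic_X_sub_C _).pow 2⟩
    rw [natDegree_prod_of_monic _ _ fun i _ => (monic_X_sub_C _).pow 2]
    simp [natDegree_pow, (Finset.mem_powersetCard.1 hs).2, mul_comm]
  refine ⟨C (subdiscSum (m + 1) x) + ∑ s ∈ Finset.powersetCard m (Finset.univ : Finset (Fin n)),
    C (∏ p ∈ (s ×ˢ s).filter (fun p => p.1 < p.2), (x p.1 - x p.2) ^ 2) *
      ∏ i ∈ s, (X - C (x i)) ^ 2, ?_, ?_, ?_⟩
  · refine natDegree_add_le_of_degree_le (by simp) (natDegree_sum_le_of_forall_le _ _ fun s hs => ?_)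
    exact (natDegree_C_mul_le _ _).trans (hprod s hs).1.le
  · rw [coeff_add, coeff_C_of_ne_zero (by omega), zero_add, finsetSum_coeff, subdiscSum]
    refine Finset.sum_congr rfl fun s hs => ?_
    have := (hprod s hs).2.coeff_natDegree
    rw [(hprod s hs).1] at this
    rw [coeff_C_mul, this, mul_one]
  · intro z
    rw [subdiscSum_cons]
    simp [eval_finsetSum, eval_prod]

theorem MvPolynomial.differentiable_eval {n : ℕ} (p : MvPolynomial (Fin n) ℝ) :
    Differentiable ℝ fun x => MvPolynomial.eval x p := fun x =>
  (AnalyticOnNhd.eval_mvPolynomial p x (Set.mem_univ x)).differentiableAt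

theorem PermInvariant.coeff_finSuccEquiv {n : ℕ} {p : MvPolynomial (Fin (n + 1)) ℝ}
    (hp : PermInvariant fun x => MvPolynomial.eval x p) (d : ℕ) :
    PermInvariant fun x => MvPolynomial.eval x ((MvPolynomial.finSuccEquiv ℝ n p).coeff d) := by
  intro e x
  have h : Polynomial.map (MvPolynomial.eval (x ∘ e)) (MvPolynomial.finSuccEquiv ℝ n p) =
      Polynomial.map (MvPolynomial.eval x) (MvPolynomial.finSuccEquiv ℝ n p) := by
    refine Polynomial.funext fun z => ?_
    rw [← MvPolynomial.eval_eq_eval_mv_eval', ← MvPolynomial.eval_eq_eval_mv_eval']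
    refine Eq.trans ?_ (hp (Equiv.Perm.decomposeFin.symm (0, e)) (Fin.cons z x))
    simp only
    congr 2
    funext i
    refine Fin.cases ?_ (fun j => ?_) i <;> simp
  simpa only [Polynomial.coeff_map] using congr_arg (fun P => P.coeff d) h

theorem VanishesBelow.coeff_finSuccEquiv {n m : ℕ} {p : MvPolynomial (Fin (n + 1)) ℝ}
    (hp : VanishesBelow (m + 1) fun x => MvPolynomial.eval x p) (d : ℕ) :
    VanishesBelow m fun x => MvPolynomial.eval x ((MvPolynomial.finSuccEquiv ℝ n p).coeff d) := by
  intro x hx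
  have h : Polynomial.map (MvPolynomial.eval x) (MvPolynomial.finSuccEquiv ℝ n p) = 0 := by
    refine Polynomial.funext fun z => ?_
    rw [← MvPolynomial.eval_eq_eval_mv_eval', Polynomial.eval_zero]
    refine hp _ ?_
    have hsub : Finset.univ.image (Fin.cons z x : Fin (n + 1) → ℝ) ⊆
        insert z (Finset.univ.image x) := by
      intro v hv
      obtain ⟨i, -, rfl⟩ := Finset.mem_image.1 hv
      refine Fin.cases ?_ (fun j => ?_) i <;> simp
    have := (Finset.card_le_card hsub).trans (Finset.card_insert_le _ _)
    omega
  simpa only [Polynomial.coeff_map, Polynomial.coeff_zero] using congr_arg (fun P => P.coeff d) h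

open Function in
theorem exists_eval_eq_mul_subdiscSum (m : ℕ) : ∀ (n : ℕ) (p : MvPolynomial (Fin n) ℝ), m + 1 ≤ n →
    PermInvariant (fun x => MvPolynomial.eval x p) →
    VanishesBelow (m + 1) (fun x => MvPolynomial.eval x p) →
    p.totalDegree ≤ (m + 1) * m →
    ∃ c : ℝ, (p.totalDegree < (m + 1) * m → c = 0) ∧
      ∀ x, MvPolynomial.eval x p = c * subdiscSum (m + 1) x := by
  induction m with
  | zero =>
    intro n p hn hsym hv hdeg
    have hp := MvPolynomial.totalDegree_eq_zero_iff_eq_C.1 (by omega : p.totalDegree = 0)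
    refine ⟨p.coeff 0 / n, fun h => by omega, fun x => ?_⟩
    have hsum : subdiscSum (0 + 1) x = (n : ℝ) := by
      have : ∀ s ∈ Finset.powersetCard (0 + 1) (Finset.univ : Finset (Fin n)),
          ∏ p ∈ (s ×ˢ s).filter (fun p => p.1 < p.2), (x p.1 - x p.2) ^ 2 = 1 := by
        intro s hs
        obtain ⟨a, rfl⟩ := Finset.card_eq_one.1 (Finset.mem_powersetCard.1 hs).2
        refine Finset.prod_eq_one fun p hp => ?_
        simp only [Finset.mem_filter, Finset.mem_product, Finset.mem_singleton] at hp
        exact absurd hp.2 (by simp [hp.1.1, hp.1.2])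
      rw [subdiscSum, Finset.sum_congr rfl this]
      simp
    have hn0 : (n : ℝ) ≠ 0 := Nat.cast_ne_zero.2 (by omega)
    rw [hsum, div_mul_cancel₀ _ hn0]
    conv_lhs => rw [hp]
    simp
  | succ m ih =>
    intro n p hn hsym hv hdeg
    obtain ⟨n, rfl⟩ : ∃ k, n = k + 1 := ⟨n - 1, by omega⟩
    have hexp : (m + 1 + 1) * (m + 1) = (m + 1) * m + 2 * (m + 1) := by ring
    have hcoeff : ∀ d, 2 * (m + 1) ≤ d → ∃ c : ℝ,
        (p.totalDegree < (m + 1) * m + d → c = 0) ∧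
        ∀ x, MvPolynomial.eval x ((MvPolynomial.finSuccEquiv ℝ n p).coeff d) =
          c * subdiscSum (m + 1) x := by
      intro d hd
      by_cases h0 : (MvPolynomial.finSuccEquiv ℝ n p).coeff d = 0
      · exact ⟨0, fun _ => rfl, fun x => by simp [h0]⟩
      have hle := MvPolynomial.totalDegree_coeff_finSuccEquiv_add_le p d h0
      obtain ⟨c, hc, h⟩ := ih n _ (by omega) (hsym.coeff_finSuccEquiv d)
        (hv.coeff_finSuccEquiv d) (by omega)
      exact ⟨c, fun h => hc (by omega), h⟩
    obtain ⟨c, hc, hcx⟩ := hcoeff (2 * (m + 1)) le_rfl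
    refine ⟨c, fun h => hc (by omega), ?_⟩
    set q : MvPolynomial (Fin (n + 1)) ℝ :=
      p - MvPolynomial.C c * subdiscSum (m + 1 + 1) MvPolynomial.X with hq
    have hqe : ∀ x, MvPolynomial.eval x q =
        MvPolynomial.eval x p - c * subdiscSum (m + 1 + 1) x := by
      intro x
      simp [hq, eval_subdiscSum_X]
    have hqsym : PermInvariant fun x => MvPolynomial.eval x q := by
      intro e x
      have h1 := hsym e x
      have h2 := permInvariant_subdiscSum (m + 1 + 1) e x
      simp only at h1 h2
      simp only [hqe, h1, h2]
    have hqv : VanishesBelow (m + 1 + 1) fun x => MvPolynomial.eval x q := by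
      intro x hx
      have h1 := hv x hx
      have h2 := vanishesBelow_subdiscSum (m + 1 + 1) x hx
      simp only at h1 h2
      simp only [hqe, h1, h2, mul_zero, sub_zero]
    have hqdeg : ∀ x s, ∃ P : Polynomial ℝ, P.natDegree < 2 * (m + 1) ∧
        ∀ z, P.eval z = MvPolynomial.eval (update x s z) q := by
      intro x s
      set t : Fin n → ℝ := Fin.tail (x ∘ Equiv.swap s 0) with ht
      obtain ⟨Q, hQ, hQc, hQe⟩ := exists_polynomial_subdiscSum_cons m.succ_ne_zero t
      refine ⟨Polynomial.map (MvPolynomial.eval t) (MvPolynomial.finSuccEquiv ℝ n p) -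
        Polynomial.C c * Q, ?_, fun z => ?_⟩
      · refine Nat.lt_succ_of_le (n := _) (m := 2 * m + 1)
          (Polynomial.natDegree_le_iff_coeff_eq_zero.2 ?_)
        intro d hd
        rw [Polynomial.coeff_sub, Polynomial.coeff_C_mul, Polynomial.coeff_map]
        rcases eq_or_ne d (2 * (m + 1)) with rfl | hne
        · rw [hcx, hQc, sub_self]
        · obtain ⟨c', hc', h⟩ := hcoeff d (by omega)
          rw [h, hc' (by omega), 
            Polynomial.coeff_eq_zero_of_natDegree_lt (by omega : Q.natDegree < d)]
          simp
      · have h := hqsym.update_swap x s 0 z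
        rw [← h]
        have hcons : update (x ∘ Equiv.swap s 0) 0 z = Fin.cons z t := by
          rw [← Fin.cons_self_tail (x ∘ Equiv.swap s 0), Fin.update_cons_zero, ht]
        rw [hcons, hqe, MvPolynomial.eval_eq_eval_mv_eval', Polynomial.eval_sub,
          Polynomial.eval_mul, Polynomial.eval_C, hQe]
    intro x
    have := hqsym.eq_zero q.differentiable_eval hqdeg hqv x
    rw [hqe] at this
    exact sub_eq_zero.1 this

theorem MvPolynomial.totalDegree_aeval_le {σ τ : Type*} {R : Type*} [CommRing R]
    (g : σ → MvPolynomial τ R) (hg : ∀ i, (g i).totalDegree ≤ 1) (f : MvPolynomial σ R) :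
    (MvPolynomial.aeval g f).totalDegree ≤ f.totalDegree := by
  rw [MvPolynomial.aeval_def, MvPolynomial.eval₂_eq]
  refine MvPolynomial.totalDegree_finsetSum_le fun d hd => ?_
  refine (MvPolynomial.totalDegree_mul _ _).trans ?_
  rw [MvPolynomial.algebraMap_eq, MvPolynomial.totalDegree_C, zero_add]
  refine (MvPolynomial.totalDegree_finsetProd _ _).trans ?_
  refine le_trans (Finset.sum_le_sum fun i _ => ?_) (MvPolynomial.le_totalDegree hd)
  exact (MvPolynomial.totalDegree_pow _ _).trans
    ((Nat.mul_le_mul_left _ (hg i)).trans (mul_one _).le)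

open Matrix in
theorem SOInvariant.eval_conj_diagonal {n : ℕ} {f : MvPolynomial (Fin n × Fin n) ℝ}
    (hf : SOInvariant n f) {g : Matrix (Fin n) (Fin n) ℝ} (hg : g * gᵀ = 1) (x : Fin n → ℝ) :
    MvPolynomial.eval (fun p => (g * diagonal x * gᵀ) p.1 p.2) f =
      MvPolynomial.eval (fun p => (diagonal x : Matrix (Fin n) (Fin n) ℝ) p.1 p.2) f := by
  have hx : (diagonal x : Matrix (Fin n) (Fin n) ℝ).IsHermitian := by
    simp [IsHermitian]
  have hdet : g.det * g.det = 1 := by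
    simpa using congr_arg det hg
  rcases mul_self_eq_one_iff.1 hdet with h | h
  · exact hf g _ hg h hx
  obtain ⟨n, rfl⟩ : ∃ k, n = k + 1 := by
    refine ⟨n - 1, ?_⟩
    rcases n with _ | n
    · norm_num [det_fin_zero] at h
    · rfl
  set r : Matrix (Fin (n + 1)) (Fin (n + 1)) ℝ := diagonal (Fin.cons (-1) fun _ => 1) with hr
  have hrt : rᵀ = r := diagonal_transpose _
  have hrr : r * r = 1 := by
    rw [hr, diagonal_mul_diagonal, ← diagonal_one]
    congr 1
    funext i
    refine Fin.cases ?_ (fun j => ?_) i <;> simp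
  have hrx : r * diagonal x * r = diagonal x := by
    have : r * diagonal x = diagonal x * r := by
      simp only [hr, diagonal_mul_diagonal, mul_comm]
    rw [this, mul_assoc, hrr, mul_one]
  have hdr : r.det = -1 := by
    simp [hr, det_diagonal, Fin.prod_univ_succ]
  have hconj : (g * r) * diagonal x * (g * r)ᵀ = g * diagonal x * gᵀ := by
    calc _ = g * (r * diagonal x * r) * gᵀ := by
          rw [transpose_mul, hrt]; simp only [mul_assoc]
      _ = _ := by rw [hrx]
  rw [← hconj]
  refine hf (g * r) _ ?_ ?_ hx
  · rw [transpose_mul, hrt, mul_assoc, ← mul_assoc r, hrr, one_mul, hg]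
  · rw [det_mul, h, hdr]; norm_num

/-- The restriction of a polynomial in the entries of a matrix to the diagonal matrices. -/
noncomputable def diagonalRestriction {n : ℕ} (f : MvPolynomial (Fin n × Fin n) ℝ) :
    MvPolynomial (Fin n) ℝ :=
  MvPolynomial.aeval (fun p => if p.1 = p.2 then MvPolynomial.X p.1 else 0) f

open Matrix in
theorem eval_diagonalRestriction {n : ℕ} (f : MvPolynomial (Fin n × Fin n) ℝ) (x : Fin n → ℝ) :
    MvPolynomial.eval x (diagonalRestriction f) =
      MvPolynomial.eval (fun p => (diagonal x : Matrix (Fin n) (Fin n) ℝ) p.1 p.2) f := by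
  rw [diagonalRestriction, ← MvPolynomial.coe_aeval_eq_eval, RingHom.coe_coe,
    ← AlgHom.comp_apply, MvPolynomial.comp_aeval, ← MvPolynomial.aeval_eq_eval]
  congr 2
  funext p
  by_cases h : p.1 = p.2 <;> simp [h]

theorem totalDegree_diagonalRestriction_le {n : ℕ} (f : MvPolynomial (Fin n × Fin n) ℝ) :
    (diagonalRestriction f).totalDegree ≤ f.totalDegree := by
  refine MvPolynomial.totalDegree_aeval_le _ (fun p => ?_) f
  split_ifs <;> simp

open Matrix in
theorem SOInvariant.permInvariant_diagonalRestriction {n : ℕ}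
    {f : MvPolynomial (Fin n × Fin n) ℝ} (hf : SOInvariant n f) :
    PermInvariant fun x => MvPolynomial.eval x (diagonalRestriction f) := by
  intro e x
  simp only [eval_diagonalRestriction]
  have hg : (e.permMatrix ℝ) * (e.permMatrix ℝ)ᵀ = 1 := by
    rw [transpose_permMatrix, ← permMatrix_mul, inv_mul_cancel, permMatrix_one]
  rw [← hf.eval_conj_diagonal hg x]
  congr 2
  funext p
  rw [transpose_permMatrix, PEquiv.toMatrix_toPEquiv_mul, PEquiv.mul_toMatrix_toPEquiv]
  have hinv : (Equiv.symm e⁻¹) p.2 = e p.2 := rfl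
  simp [diagonal_apply, hinv]

open Matrix in
theorem VanishesOnEk.vanishesBelow_diagonalRestriction {n k : ℕ}
    {f : MvPolynomial (Fin n × Fin n) ℝ} (hf : VanishesOnEk n k f) :
    VanishesBelow (n - k) fun x => MvPolynomial.eval x (diagonalRestriction f) := by
  intro x hx
  have hA : (diagonal x : Matrix (Fin n) (Fin n) ℝ).IsHermitian := by
    simp [IsHermitian]
  simp only [eval_diagonalRestriction]
  refine hf _ hA ?_
  have hrange := hA.spectrum_real_eq_range_eigenvalues
  rw [spectrum_diagonal] at hrange
  have : Finset.univ.image hA.eigenvalues = Finset.univ.image x := by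
    rw [← Finset.coe_inj]
    simp [hrange]
  rw [this]
  omega

open Matrix in
theorem SOInvariant.eval_eq_eval_eigenvalues {n : ℕ} {f : MvPolynomial (Fin n × Fin n) ℝ}
    (hf : SOInvariant n f) {A : Matrix (Fin n) (Fin n) ℝ} (hA : A.IsHermitian) :
    MvPolynomial.eval (fun p => A p.1 p.2) f =
      MvPolynomial.eval hA.eigenvalues (diagonalRestriction f) := by
  have hU : (hA.eigenvectorUnitary : Matrix (Fin n) (Fin n) ℝ) *
      (hA.eigenvectorUnitary : Matrix (Fin n) (Fin n) ℝ)ᵀ = 1 := by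
    have := mem_unitaryGroup_iff.1 hA.eigenvectorUnitary.2
    rwa [star_eq_conjTranspose, conjTranspose_eq_transpose_of_trivial] at this
  rw [eval_diagonalRestriction, ← hf.eval_conj_diagonal hU]
  have h := hA.spectral_theorem
  rw [Unitary.conjStarAlgAut_apply] at h
  congr 2
  funext p
  conv_lhs => rw [h]
  rfl

/-- Every `SOₙ`-invariant homogeneous polynomial function of degree `(n−k)(n−k−1)` on real
symmetric matrices vanishing on `E_k` is a scalar multiple of `sDisc_k`, and every
`SOₙ`-invariant polynomial of smaller degree vanishing on `E_k` is zero (as a function on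
the space of symmetric matrices). -/
theorem stmt16 (n k : ℕ) (hn : 2 ≤ n) (hk : k ≤ n - 2) :
    (∀ f : MvPolynomial (Fin n × Fin n) ℝ, SOInvariant n f →
      f.IsHomogeneous ((n - k) * (n - k - 1)) → VanishesOnEk n k f →
      ∃ c : ℝ, ∀ (A : Matrix (Fin n) (Fin n) ℝ) (hA : A.IsHermitian),
        MvPolynomial.eval (fun p => A p.1 p.2) f = c * sDiscVal n k hA.eigenvalues) ∧
    (∀ f : MvPolynomial (Fin n × Fin n) ℝ, SOInvariant n f →
      f.totalDegree < (n - k) * (n - k - 1) → VanishesOnEk n k f →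
      ∀ A : Matrix (Fin n) (Fin n) ℝ, A.IsHermitian →
        MvPolynomial.eval (fun p => A p.1 p.2) f = 0) := by
  have key : ∀ f : MvPolynomial (Fin n × Fin n) ℝ, SOInvariant n f → VanishesOnEk n k f →
      f.totalDegree ≤ (n - k) * (n - k - 1) →
      ∃ c : ℝ, (f.totalDegree < (n - k) * (n - k - 1) → c = 0) ∧
        ∀ x, MvPolynomial.eval x (diagonalRestriction f) = c * sDiscVal n k x := by
    intro f hf hv hdeg
    have hle := totalDegree_diagonalRestriction_le f
    have hm : n - k - 1 + 1 = n - k := by omega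
    have h := exists_eval_eq_mul_subdiscSum (n - k - 1) n (diagonalRestriction f) (by omega)
      hf.permInvariant_diagonalRestriction
    rw [hm] at h
    obtain ⟨c, hc, hx⟩ := h hv.vanishesBelow_diagonalRestriction (hle.trans hdeg)
    exact ⟨c, fun h => hc (hle.trans_lt h), hx⟩
  refine ⟨fun f hf hdeg hv => ?_, fun f hf hdeg hv A hA => ?_⟩
  · obtain ⟨c, -, hc⟩ := key f hf hv hdeg.totalDegree_le
    exact ⟨c, fun A hA => by rw [hf.eval_eq_eval_eigenvalues hA, hc]⟩
  · obtain ⟨c, hc0, hc⟩ := key f hf hv hdeg.le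
    rw [hf.eval_eq_eval_eigenvalues hA, hc, hc0 hdeg, zero_mul]
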